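/- arXiv:1204.1166 — 2 statements merged into one kernel-verified Lean document; each statement's English description precedes it below -/
import Mathlib

section
/- Let p be a prime and let G̃ be a finite group which has a subquotient isomorphic either to C_p × C_p or to a nonabelian semidirect product C_p ⋊ C_q with q prime and C_q acting faithfully on C_p. Then there exists a Brauer relation Θ = ∑_H n_H·H in G̃ with ord_p(∏_H |H|^{n_H}) ≠ 0. Moreover, Θ can be taken to be obtained by inflation and induction from the relation 1 − ∑_{U ≤_p G} U + p·G in G = C_p × C_p in the former case, and from the relation 1 − q·C_q − C_p + q·G in G = C_p ⋊ C_q in the latter case. -/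
/-- The number of cosets in `G ⧸ H` fixed by left translation by `g`;
this is the value at `g` of the character of the permutation representation `ℂ[G/H]`. -/
noncomputable def fixedCosets {G : Type*} [Group G] (g : G) (H : Subgroup G) : ℕ :=
  Nat.card {x : G ⧸ H // g • x = x}

open Classical in
/-- The coefficients of the Brauer relation `1 − ∑_{U ≤_p G} U + p·G` in `G = C_p × C_p`. -/
noncomputable def cpcpRel (p : ℕ) : Subgroup (Multiplicative (ZMod p × ZMod p)) → ℤ :=
  fun T => if T = ⊥ then 1 else if Nat.card T = p then -1 else if T = ⊤ then (p : ℤ) else 0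

open Classical in
/-- The coefficients of the Brauer relation `1 − q·C_q − C_p + q·G` in `G = C_p ⋊ C_q`,
where `C_p = inl(C_p)` and `C_q = inr(C_q)`. -/
noncomputable def pqRel (p q : ℕ)
    (φ : Multiplicative (ZMod q) →* MulAut (Multiplicative (ZMod p))) :
    Subgroup (Multiplicative (ZMod p) ⋊[φ] Multiplicative (ZMod q)) → ℤ :=
  fun T => if T = ⊥ then 1
    else if T = (SemidirectProduct.inr :
        Multiplicative (ZMod q) →* Multiplicative (ZMod p) ⋊[φ] Multiplicative (ZMod q)).range
      then -(q : ℤ)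
    else if T = (SemidirectProduct.inl :
        Multiplicative (ZMod p) →* Multiplicative (ZMod p) ⋊[φ] Multiplicative (ZMod q)).range
      then -1
    else if T = ⊤ then (q : ℤ) else 0


theorem fc_mul_card {G : Type*} [Group G] [Finite G] (g : G) (S : Subgroup G) :
    Nat.card S * fixedCosets g S = Nat.card {x : G // x⁻¹ * g * x ∈ S} := by
  unfold fixedCosets
  rw [← Nat.card_prod]
  symm
  refine Nat.card_congr ((Equiv.subtypeEquivRight ?_).trans
    (QuotientGroup.preimageMkEquivSubgroupProdSet S {x : G ⧸ S | g • x = x}))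
  intro x
  simp only [Set.mem_preimage, Set.mem_ofPred_eq]
  rw [eq_comm, ← QuotientGroup.mk_mul_of_mem x (one_mem S)]
  simp only [mul_one]
  change _ ↔ ((x : G ⧸ S)) = ((g * x : G) : G ⧸ S)
  rw [QuotientGroup.eq, mul_assoc]

theorem card_fiber {H Q : Type*} [Group H] [Group Q] [Finite H] (f : H →* Q)
    (hf : Function.Surjective f) (P : Q → Prop) :
    Nat.card {h : H // P (f h)} = Nat.card f.ker * Nat.card {z : Q // P z} := by
  let e := QuotientGroup.quotientKerEquivOfSurjective f hf
  rw [← Nat.card_congr (e.toEquiv.subtypeEquiv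
    (p := fun x => P (e x)) (q := P) (fun a => Iff.rfl)), ← Nat.card_prod]
  exact Nat.card_congr
    (QuotientGroup.preimageMkEquivSubgroupProdSet f.ker {x : H ⧸ f.ker | P (e x)})

theorem card_pull {G Q : Type*} [Group G] [Group Q] [Finite G] (H : Subgroup G) (f : H →* Q)
    (hf : Function.Surjective f) (T : Subgroup Q) :
    Nat.card ((T.comap f).map H.subtype) = Nat.card f.ker * Nat.card T := by
  rw [Nat.card_congr (((T.comap f).equivMapOfInjective H.subtype
    H.subtype_injective).toEquiv).symm]
  exact card_fiber f hf (fun z => z ∈ T)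

open Classical in
theorem fc_ind {G Q : Type*} [Group G] [Group Q] [Fintype G] [Finite Q] (H : Subgroup G)
    (f : H →* Q) (hf : Function.Surjective f) (T : Subgroup Q) (g : G) :
    Nat.card H * fixedCosets g ((T.comap f).map H.subtype) =
      ∑ x : G, if hx : x⁻¹ * g * x ∈ H then fixedCosets (f ⟨_, hx⟩) T else 0 := by
  have hk : 0 < Nat.card f.ker * Nat.card T := Nat.mul_pos Nat.card_pos Nat.card_pos
  apply Nat.eq_of_mul_eq_mul_left hk
  set S := (T.comap f).map H.subtype with hS
  have hmem : ∀ (y : G), y ∈ S ↔ ∃ hy : y ∈ H, f ⟨y, hy⟩ ∈ T := by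
    intro y
    simp [hS, Subgroup.mem_map]
  calc _ = Nat.card H * (Nat.card S * fixedCosets g S) := by
            rw [card_pull H f hf T]; ring
    _ = Nat.card H * Nat.card {x : G // x⁻¹ * g * x ∈ S} := by rw [fc_mul_card]
    _ = Nat.card (Σ x : G, {h : H // (h : G)⁻¹ * (x⁻¹ * g * x) * h ∈ S}) := by
      rw [← Nat.card_prod]
      refine Nat.card_congr ⟨fun a => ⟨a.2.1 * (a.1 : G)⁻¹, a.1, ?_⟩,
        fun b => ⟨b.2.1, b.1 * (b.2.1 : G), ?_⟩, ?_, ?_⟩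
      · have := a.2.2
        convert this using 1
        group
      · have := b.2.2
        convert this using 1
        group
      · rintro ⟨a, x, hx⟩
        simp
      · rintro ⟨x, h, hx⟩
        exact Sigma.subtype_ext (by simp) rfl
    _ = ∑ x : G, Nat.card {h : H // (h : G)⁻¹ * (x⁻¹ * g * x) * h ∈ S} := by
      rw [Nat.card_sigma]
    _ = _ := by
      rw [Finset.mul_sum]
      refine Finset.sum_congr rfl fun x _ => ?_
      split_ifs with hx
      · rw [mul_assoc (Nat.card f.ker), fc_mul_card, ← card_fiber f hf
          (fun z => z⁻¹ * f ⟨_, hx⟩ * z ∈ T)]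
        refine Nat.card_congr (Equiv.subtypeEquivRight fun h => ?_)
        rw [hmem]
        have e : ((h : G)⁻¹ * (x⁻¹ * g * x) * h) = ((h⁻¹ * ⟨_, hx⟩ * h : H) : G) := rfl
        rw [← map_inv, ← map_mul, ← map_mul]
        exact ⟨fun ⟨_, h2⟩ => h2, fun h2 => ⟨SetLike.coe_mem (h⁻¹ * ⟨_, hx⟩ * h : H), h2⟩⟩
      · rw [mul_zero, Nat.card_eq_zero]
        left
        constructor
        rintro ⟨h, hh⟩
        obtain ⟨h1, -⟩ := (hmem _).1 hh
        apply hx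
        have := H.mul_mem (H.mul_mem h.2 h1) (H.inv_mem h.2)
        convert this using 1
        group

open Classical in
theorem sum_push {A B : Type*} [Fintype A] [Fintype B] (F : A → B) (m : A → ℤ) (c : B → ℤ) :
    ∑ S : B, (∑ᶠ T ∈ {T : A | F T = S}, m T) * c S = ∑ T : A, m T * c (F T) := by
  rw [← Finset.sum_fiberwise Finset.univ F]
  refine Finset.sum_congr rfl fun S _ => ?_
  rw [finsum_mem_eq_finite_toFinset_sum _ (Set.toFinite _), Finset.sum_mul]
  refine Finset.sum_congr (by ext; simp) fun T hT => ?_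
  simp at hT
  rw [hT]

theorem padic_prod {p : ℕ} [Fact p.Prime] {B : Type*} (s : Finset B) (a : B → ℕ)
    (ha : ∀ b, a b ≠ 0) (n : B → ℤ) :
    padicValRat p (∏ b ∈ s, (a b : ℚ) ^ n b) = ∑ b ∈ s, n b * (padicValNat p (a b) : ℤ) := by
  classical
  induction s using Finset.induction_on with
  | empty => simp
  | insert b s hb ih =>
    rw [Finset.prod_insert hb, Finset.sum_insert hb, padicValRat.mul, ih, padicValRat.zpow,
      padicValRat.of_nat]
    · exact zpow_ne_zero _ (by exact_mod_cast ha b)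
    · exact Finset.prod_ne_zero_iff.2 fun c _ => zpow_ne_zero _ (by exact_mod_cast ha c)

theorem general {G Q : Type*} [Group G] [Group Q] [Finite G] [Fintype (Subgroup Q)] [Finite Q]
    (p : ℕ) (hp : p.Prime) (H : Subgroup G)
    (f : H →* Q) (hf : Function.Surjective f) (m : Subgroup Q → ℤ)
    (hm : ∀ y : Q, ∑ T : Subgroup Q, m T * (fixedCosets y T : ℤ) = 0)
    (hm0 : ∑ T : Subgroup Q, m T = 0)
    (hv : ∑ T : Subgroup Q, m T * (padicValNat p (Nat.card T) : ℤ) ≠ 0)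
    (n : Subgroup G → ℤ)
    (hn : n = fun S => ∑ᶠ T ∈ {T : Subgroup Q | (T.comap f).map H.subtype = S}, m T) :
    (∀ g : G, ∑ᶠ S : Subgroup G, n S * (fixedCosets g S : ℤ) = 0) ∧
      padicValRat p (∏ᶠ S : Subgroup G, (Nat.card S : ℚ) ^ (n S)) ≠ 0 := by
  classical
  have := Fact.mk hp
  have := Fintype.ofFinite G
  have := Fintype.ofFinite (Subgroup G)
  constructor
  · intro g
    rw [finsum_eq_sum_of_fintype, hn]
    rw [sum_push (fun T : Subgroup Q => (T.comap f).map H.subtype) m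
      (fun S => (fixedCosets g S : ℤ))]
    have hH : (Nat.card H : ℤ) ≠ 0 := by exact_mod_cast Nat.card_pos.ne'
    refine (mul_eq_zero.1 (?_ : (Nat.card H : ℤ) * _ = 0)).resolve_left hH
    rw [Finset.mul_sum]
    have key : ∀ T : Subgroup Q, (Nat.card H : ℤ) *
        (m T * (fixedCosets g ((T.comap f).map H.subtype) : ℤ)) =
        ∑ x : G, if hx : x⁻¹ * g * x ∈ H then m T * (fixedCosets (f ⟨_, hx⟩) T : ℤ) else 0 := by
      intro T
      have h1 := congrArg (Nat.cast : ℕ → ℤ) (fc_ind H f hf T g)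
      rw [mul_left_comm, ← Nat.cast_mul, h1, Nat.cast_sum, Finset.mul_sum]
      refine Finset.sum_congr rfl fun x _ => ?_
      split_ifs <;> simp
    rw [Finset.sum_congr rfl fun T _ => key T, Finset.sum_comm]
    refine Finset.sum_eq_zero fun x _ => ?_
    split_ifs with hx
    · exact hm _
    · simp
  · rw [finprod_eq_prod_of_fintype, padic_prod _ _ (fun S => Nat.card_pos.ne'), hn,
      sum_push (fun T : Subgroup Q => (T.comap f).map H.subtype) m
      (fun S => (padicValNat p (Nat.card S) : ℤ))]
    have : ∀ T : Subgroup Q, m T * (padicValNat p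
        (Nat.card ((T.comap f).map H.subtype)) : ℤ) =
        m T * (padicValNat p (Nat.card f.ker) : ℤ) + m T * (padicValNat p (Nat.card T) : ℤ) := by
      intro T
      rw [card_pull H f hf T, padicValNat.mul Nat.card_pos.ne' Nat.card_pos.ne']
      push_cast; ring
    rw [Finset.sum_congr rfl fun T _ => this T, Finset.sum_add_distrib, ← Finset.sum_mul, hm0,
      zero_mul, zero_add]
    exact hv

theorem fc_top {G : Type*} [Group G] [Finite G] (g : G) : fixedCosets g (⊤ : Subgroup G) = 1 := by
  have h := fc_mul_card g (⊤ : Subgroup G)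
  have e : Nat.card {x : G // x⁻¹ * g * x ∈ (⊤ : Subgroup G)} = Nat.card (⊤ : Subgroup G) :=
    Nat.card_congr (Equiv.subtypeEquivRight fun x => by simp)
  rw [e] at h
  exact Nat.eq_of_mul_eq_mul_left (Nat.card_pos (α := (⊤ : Subgroup G))) (by rw [h, mul_one])

theorem fc_one {G : Type*} [Group G] [Finite G] (S : Subgroup G) :
    Nat.card S * fixedCosets 1 S = Nat.card G := by
  rw [fc_mul_card]
  exact Nat.card_congr (Equiv.subtypeUnivEquiv fun x => by simp [S.one_mem])

theorem fc_normal_mem {G : Type*} [Group G] [Finite G] (S : Subgroup G) [hS : S.Normal] (g : G)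
    (hg : g ∈ S) : Nat.card S * fixedCosets g S = Nat.card G := by
  rw [fc_mul_card]
  exact Nat.card_congr (Equiv.subtypeUnivEquiv fun x => by
    simpa using hS.conj_mem g hg x⁻¹)

theorem fc_normal_notMem {G : Type*} [Group G] [Finite G] (S : Subgroup G) [hS : S.Normal] (g : G)
    (hg : g ∉ S) : fixedCosets g S = 0 := by
  have h := fc_mul_card g S
  have : IsEmpty {x : G // x⁻¹ * g * x ∈ S} := ⟨fun ⟨x, hx⟩ => hg (by
    have := hS.conj_mem _ hx x
    convert this using 1
    group)⟩
  rw [Nat.card_of_isEmpty (α := {x : G // x⁻¹ * g * x ∈ S})] at h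
  exact (Nat.mul_eq_zero.1 h).resolve_left Nat.card_pos.ne'

section cpcp

variable {Q : Type*} [CommGroup Q] [Fintype Q]

open Classical in
theorem uniqueU (p : ℕ) (hp : p.Prime) (hexp : ∀ y : Q, y ^ p = 1) (y : Q) (hy : y ≠ 1)
    (U : Subgroup Q) : (Nat.card U = p ∧ y ∈ U) ↔ U = Subgroup.zpowers y := by
  have := Fact.mk hp
  have ho : Nat.card (Subgroup.zpowers y) = p := by
    rw [Nat.card_zpowers, orderOf_eq_prime (hexp y) hy]
  constructor
  · rintro ⟨h1, h2⟩
    exact (Subgroup.eq_of_le_of_card_ge (Subgroup.zpowers_le.2 h2) (by rw [ho, h1])).symm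
  · rintro rfl
    exact ⟨ho, Subgroup.mem_zpowers y⟩

open Classical in
theorem sumU (p : ℕ) (hp : p.Prime) [Fintype (Subgroup Q)]
    (hexp : ∀ y : Q, y ^ p = 1) (y : Q) (hy : y ≠ 1) :
    ∑ U ∈ Finset.univ.filter (fun U : Subgroup Q => Nat.card U = p), (if y ∈ U then (1 : ℤ) else 0) = 1 := by
  rw [← Finset.sum_filter, Finset.filter_filter]
  have e : (Finset.univ.filter fun U : Subgroup Q => Nat.card U = p ∧ y ∈ U) =
      {Subgroup.zpowers y} := by
    ext U
    rw [Finset.mem_filter, uniqueU p hp hexp y hy U, Finset.mem_singleton]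
    simp
  rw [e]
  simp

open Classical in
theorem countU (p : ℕ) (hp : p.Prime) [Fintype (Subgroup Q)]
    (hexp : ∀ y : Q, y ^ p = 1) (hc : Nat.card Q = p ^ 2) :
    ((Finset.univ.filter fun U : Subgroup Q => Nat.card U = p).card : ℤ) = p + 1 := by
  have h1 : ∑ U ∈ Finset.univ.filter (fun U : Subgroup Q => Nat.card U = p), ∑ y : Q, (if y ∈ U then (1 : ℤ) else 0) =
      (Finset.univ.filter fun U : Subgroup Q => Nat.card U = p).card * p := by
    rw [Finset.sum_congr rfl (g := fun _ => (p : ℤ)), Finset.sum_const, nsmul_eq_mul]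
    intro U hU
    simp only [Finset.mem_filter, Finset.mem_univ, true_and] at hU
    rw [Finset.sum_boole, ← hU, Nat.card_eq_fintype_card, Fintype.card_subtype]
  rw [Finset.sum_comm, ← Finset.add_sum_erase _ _ (Finset.mem_univ (1 : Q)),
    Finset.sum_congr (s₁ := Finset.univ.erase 1) rfl (g := fun _ => (1 : ℤ))
      (fun y hy => sumU p hp hexp y (Finset.ne_of_mem_erase hy))] at h1
  simp only [Subgroup.one_mem, if_true, Finset.sum_const, nsmul_eq_mul, mul_one,
    Finset.card_erase_of_mem (Finset.mem_univ (1 : Q)), Finset.card_univ] at h1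
  rw [← Nat.card_eq_fintype_card, hc, Nat.cast_sub (Nat.one_le_pow _ _ hp.pos)] at h1
  push_cast at h1
  have hp1 : (p : ℤ) - 1 ≠ 0 := by have := hp.two_le; omega
  apply mul_right_cancel₀ hp1
  linarith

end cpcp

open Classical in
theorem cpcp_sum (p : ℕ) (hp : p.Prime) [Fintype (Subgroup (Multiplicative (ZMod p × ZMod p)))]
    (hc : Nat.card (Multiplicative (ZMod p × ZMod p)) = p ^ 2)
    (c : Subgroup (Multiplicative (ZMod p × ZMod p)) → ℤ) :
    ∑ T, cpcpRel p T * c T = c ⊥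
      - ∑ T ∈ Finset.univ.filter (fun T : Subgroup (Multiplicative (ZMod p × ZMod p)) =>
        Nat.card T = p), c T
      + p * c ⊤ := by
  have h2 := hp.two_le
  have hb : Nat.card (⊥ : Subgroup (Multiplicative (ZMod p × ZMod p))) = 1 := by simp
  have ht : Nat.card (⊤ : Subgroup (Multiplicative (ZMod p × ZMod p))) = p ^ 2 := by simp [hc]
  have h3 : p ^ 2 ≠ p := by nlinarith
  have h4 : (⊤ : Subgroup (Multiplicative (ZMod p × ZMod p))) ≠ ⊥ := by
    intro h
    rw [h, hb] at ht
    nlinarith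
  have key : ∀ T, cpcpRel p T * c T = (if T = ⊥ then c T else 0)
      - (if Nat.card T = p then c T else 0) + (if T = ⊤ then p * c T else 0) := by
    intro T
    unfold cpcpRel
    by_cases e1 : T = ⊥
    · subst e1
      rw [if_pos rfl, if_pos rfl, if_neg (by rw [hb]; omega), if_neg h4.symm]; ring
    by_cases e2 : T = ⊤
    · subst e2
      rw [if_neg h4, if_neg h4, if_neg (by rw [ht]; omega), if_pos rfl,
        if_pos rfl, if_neg (by rw [ht]; omega)]; ring
    by_cases e3 : Nat.card T = p
    · simp [e1, e2, e3]
    · simp [e1, e2, e3]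
  rw [Finset.sum_congr rfl fun T _ => key T, Finset.sum_add_distrib, Finset.sum_sub_distrib,
    Finset.sum_filter]
  simp

theorem cpcp_all (p : ℕ) (hp : p.Prime) [Fintype (Subgroup (Multiplicative (ZMod p × ZMod p)))] :
    (∀ y, ∑ T, cpcpRel p T * (fixedCosets y T : ℤ) = 0) ∧ ∑ T, cpcpRel p T = 0 ∧
    ∑ T, cpcpRel p T * (padicValNat p (Nat.card T) : ℤ) ≠ 0 := by
  classical
  have := Fact.mk hp
  have h2 := hp.two_le
  have hc : Nat.card (Multiplicative (ZMod p × ZMod p)) = p ^ 2 := by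
    rw [Nat.card_congr Multiplicative.toAdd, Nat.card_prod, Nat.card_zmod, sq]
  have hexp : ∀ y : Multiplicative (ZMod p × ZMod p), y ^ p = 1 := by
    intro y
    apply Multiplicative.toAdd.injective
    rw [toAdd_pow, toAdd_one]
    ext <;> simp
  have hcount := countU p hp hexp hc
  refine ⟨fun y => ?_, ?_, ?_⟩
  · rw [cpcp_sum p hp hc, fc_top]
    by_cases hy : y = 1
    · subst hy
      have hb := fc_one (⊥ : Subgroup (Multiplicative (ZMod p × ZMod p)))
      rw [hc, Subgroup.card_bot, one_mul] at hb
      rw [hb, Finset.sum_congr rfl (g := fun _ => (p : ℤ)), Finset.sum_const, nsmul_eq_mul, hcount]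
      · push_cast; ring
      · intro U hU
        simp only [Finset.mem_filter, Finset.mem_univ, true_and] at hU
        have := fc_one U
        rw [hU, hc, sq] at this
        exact_mod_cast Nat.eq_of_mul_eq_mul_left hp.pos this
    · rw [fc_normal_notMem ⊥ y (by simpa using hy),
        Finset.sum_congr rfl (g := fun U : Subgroup (Multiplicative (ZMod p × ZMod p)) => (p : ℤ) * (if y ∈ U then (1 : ℤ) else 0)),
        ← Finset.mul_sum, sumU p hp hexp y hy]
      · push_cast; ring
      · intro U hU
        simp only [Finset.mem_filter, Finset.mem_univ, true_and] at hU
        split_ifs with h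
        · have := fc_normal_mem U y h
          rw [hU, hc, sq] at this
          rw [mul_one]
          exact_mod_cast Nat.eq_of_mul_eq_mul_left hp.pos this
        · rw [fc_normal_notMem U y h]; simp
  · have := cpcp_sum p hp hc (fun _ => 1)
    simp only [mul_one, Finset.sum_const, nsmul_eq_mul, hcount] at this
    rw [this]; ring
  · rw [cpcp_sum p hp hc, Finset.sum_congr rfl (g := fun _ => (1 : ℤ)), Finset.sum_const,
      nsmul_eq_mul, hcount, Subgroup.card_bot, Subgroup.card_top, hc]
    · simp
      have : (2 : ℤ) ≤ p := by exact_mod_cast h2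
      omega
    · intro U hU
      simp only [Finset.mem_filter, Finset.mem_univ, true_and] at hU
      rw [hU]; simp

section pq

variable {p q : ℕ} {φ : Multiplicative (ZMod q) →* MulAut (Multiplicative (ZMod p))}

theorem inl_mem (x : Multiplicative (ZMod p) ⋊[φ] Multiplicative (ZMod q)) :
    x ∈ (SemidirectProduct.inl (φ := φ)).range ↔ x.right = 1 := by
  rw [SemidirectProduct.range_inl_eq_ker_rightHom, MonoidHom.mem_ker]
  rfl

theorem inr_mem (x : Multiplicative (ZMod p) ⋊[φ] Multiplicative (ZMod q)) :
    x ∈ (SemidirectProduct.inr (φ := φ)).range ↔ x.left = 1 := by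
  constructor
  · rintro ⟨y, rfl⟩; simp
  · intro h
    exact ⟨x.right, by ext <;> simp [h]⟩

theorem card_inl : Nat.card (SemidirectProduct.inl (φ := φ)).range = p := by
  rw [← Nat.card_congr (MonoidHom.ofInjective SemidirectProduct.inl_injective).toEquiv,
    Nat.card_congr Multiplicative.toAdd, Nat.card_zmod]

theorem card_inr : Nat.card (SemidirectProduct.inr (φ := φ)).range = q := by
  rw [← Nat.card_congr (MonoidHom.ofInjective SemidirectProduct.inr_injective).toEquiv,
    Nat.card_congr Multiplicative.toAdd, Nat.card_zmod]

theorem card_pq : Nat.card (Multiplicative (ZMod p) ⋊[φ] Multiplicative (ZMod q)) = p * q := by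
  rw [Nat.card_congr SemidirectProduct.equivProd, Nat.card_prod,
    Nat.card_congr Multiplicative.toAdd, Nat.card_zmod,
    Nat.card_congr Multiplicative.toAdd, Nat.card_zmod]

theorem pq_sum (hp : p.Prime) (hq : q.Prime)
    [Fintype (Subgroup (Multiplicative (ZMod p) ⋊[φ] Multiplicative (ZMod q)))]
    (c : Subgroup (Multiplicative (ZMod p) ⋊[φ] Multiplicative (ZMod q)) → ℤ) :
    ∑ T, pqRel p q φ T * c T = c ⊥ - q * c (SemidirectProduct.inr (φ := φ)).range
      - c (SemidirectProduct.inl (φ := φ)).range + q * c ⊤ := by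
  classical
  have hp2 := hp.two_le
  have hq2 := hq.two_le
  have := Fact.mk hp
  have := Fact.mk hq
  have d1 : (SemidirectProduct.inr (φ := φ)).range ≠ ⊥ := by
    intro h; have := card_inr (φ := φ); rw [h, Subgroup.card_bot] at this; omega
  have d2 : (SemidirectProduct.inl (φ := φ)).range ≠ ⊥ := by
    intro h; have := card_inl (φ := φ); rw [h, Subgroup.card_bot] at this; omega
  have d3 : (⊤ : Subgroup (Multiplicative (ZMod p) ⋊[φ] Multiplicative (ZMod q))) ≠ ⊥ := by
    intro h; have := card_pq (φ := φ); rw [← Subgroup.card_top, h, Subgroup.card_bot] at this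
    nlinarith
  have d4 : (SemidirectProduct.inl (φ := φ)).range ≠ (SemidirectProduct.inr (φ := φ)).range := by
    intro h
    apply d2
    rw [Subgroup.eq_bot_iff_forall]
    intro x hx
    have h1 := (inl_mem x).1 hx
    have h2 := (inr_mem x).1 (h ▸ hx)
    ext <;> simp [h1, h2]
  have d5 : ⊤ ≠ (SemidirectProduct.inr (φ := φ)).range := by
    intro h; have := card_pq (φ := φ); rw [← Subgroup.card_top, h, card_inr] at this
    nlinarith
  have d6 : ⊤ ≠ (SemidirectProduct.inl (φ := φ)).range := by
    intro h; have := card_pq (φ := φ); rw [← Subgroup.card_top, h, card_inl] at this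
    nlinarith
  have key : ∀ T, pqRel p q φ T * c T = (if T = ⊥ then c T else 0)
      - (if T = (SemidirectProduct.inr (φ := φ)).range then q * c T else 0)
      - (if T = (SemidirectProduct.inl (φ := φ)).range then c T else 0)
      + (if T = ⊤ then q * c T else 0) := by
    intro T
    unfold pqRel
    by_cases e1 : T = ⊥
    · subst e1
      rw [if_pos rfl, if_pos rfl, if_neg d1.symm, if_neg d2.symm, if_neg d3.symm]; ring
    by_cases e2 : T = (SemidirectProduct.inr (φ := φ)).range
    · subst e2
      rw [if_neg d1, if_neg d1, if_pos rfl, if_pos rfl, if_neg d4.symm, if_neg d5.symm]; ring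
    by_cases e3 : T = (SemidirectProduct.inl (φ := φ)).range
    · subst e3
      rw [if_neg e1, if_neg e1, if_neg e2, if_neg e2, if_pos rfl, if_pos rfl, if_neg d6.symm]; ring
    rw [if_neg e1, if_neg e1, if_neg e2, if_neg e2, if_neg e3, if_neg e3]
    split_ifs <;> ring
  rw [Finset.sum_congr rfl fun T _ => key T, Finset.sum_add_distrib, Finset.sum_sub_distrib,
    Finset.sum_sub_distrib]
  simp

theorem fc_inr (hp : p.Prime) (hq : q.Prime) (hφ : Function.Injective φ)
    (y : Multiplicative (ZMod p) ⋊[φ] Multiplicative (ZMod q)) (hy : y.right ≠ 1) :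
    fixedCosets y (SemidirectProduct.inr (φ := φ)).range = 1 := by
  have := Fact.mk hp
  have := Fact.mk hq
  have hfin : Finite (Multiplicative (ZMod p) ⋊[φ] Multiplicative (ZMod q)) :=
    Finite.of_equiv _ SemidirectProduct.equivProd.symm
  set v := y.right
  -- no nontrivial fixed points
  have hfix : ∀ a, φ v a = a → a = 1 := by
    intro a ha
    by_contra hne
    apply hy
    apply hφ
    rw [map_one]
    ext1 b
    have hb : b ∈ Subgroup.zpowers a :=
      mem_zpowers_of_prime_card (p := p)
        (by rw [Nat.card_congr Multiplicative.toAdd, Nat.card_zmod]) hne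
    obtain ⟨k, rfl⟩ := hb
    simp [ha]
  have hinj : Function.Injective fun a => a * (φ v a)⁻¹ := by
    intro a b hab
    have : φ v (a * b⁻¹) = a * b⁻¹ := by
      simp only at hab
      rw [map_mul, map_inv]
      rw [mul_inv_eq_iff_eq_mul] at hab ⊢
      conv_rhs => rw [hab]
      simp [mul_comm, mul_left_comm]
    exact mul_inv_eq_one.1 (hfix _ this)
  have hbij := Finite.injective_iff_bijective.1 hinj
  obtain ⟨a0, ha0, hu⟩ := hbij.existsUnique y.left
  have h := fc_mul_card y (SemidirectProduct.inr (φ := φ)).range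
  rw [card_inr] at h
  have hcond : ∀ x : Multiplicative (ZMod p) ⋊[φ] Multiplicative (ZMod q),
      x⁻¹ * y * x ∈ (SemidirectProduct.inr (φ := φ)).range ↔ x.left = a0 := by
    intro x
    rw [inr_mem]
    have e : (x⁻¹ * y * x).left = φ x.right⁻¹ (x.left⁻¹ * y.left * φ v x.left) := by
      simp [v, mul_assoc]
    rw [e, map_eq_one_iff _ (MulEquiv.injective _)]
    rw [mul_assoc, inv_mul_eq_one]
    constructor
    · intro hx
      exact hu _ (by simp only; rw [mul_inv_eq_iff_eq_mul]; exact hx)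
    · intro hx
      rw [hx, ← mul_inv_eq_iff_eq_mul]; exact ha0
  have hcard : Nat.card {x : Multiplicative (ZMod p) ⋊[φ] Multiplicative (ZMod q) //
      x⁻¹ * y * x ∈ (SemidirectProduct.inr (φ := φ)).range} = q := by
    refine Eq.trans (b := Nat.card (Multiplicative (ZMod q))) ?_ (by
      rw [Nat.card_congr (Multiplicative.toAdd (α := ZMod q)), Nat.card_zmod])
    refine Nat.card_congr ⟨fun x => x.1.right, fun b => ⟨⟨a0, b⟩, (hcond _).2 rfl⟩, ?_, ?_⟩
    · rintro ⟨x, hx⟩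
      have := (hcond x).1 hx
      apply Subtype.ext
      ext <;> simp [this]
    · intro b; rfl
  rw [hcard] at h
  exact Nat.eq_of_mul_eq_mul_left hq.pos (by rw [h, mul_one])

theorem pq_all (hp : p.Prime) (hq : q.Prime) (hφ : Function.Injective φ)
    [Finite (Multiplicative (ZMod p) ⋊[φ] Multiplicative (ZMod q))]
    [Fintype (Subgroup (Multiplicative (ZMod p) ⋊[φ] Multiplicative (ZMod q)))] :
    (∀ y, ∑ T, pqRel p q φ T * (fixedCosets y T : ℤ) = 0) ∧ ∑ T, pqRel p q φ T = 0 ∧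
    ∑ T, pqRel p q φ T * (padicValNat p (Nat.card T) : ℤ) ≠ 0 := by
  classical
  have := Fact.mk hp
  have := Fact.mk hq
  have hN : (SemidirectProduct.inl (φ := φ)).range.Normal := by
    rw [SemidirectProduct.range_inl_eq_ker_rightHom]; infer_instance
  refine ⟨fun y => ?_, ?_, ?_⟩
  · rw [pq_sum hp hq, fc_top]
    have key : y.right = 1 → fixedCosets y (SemidirectProduct.inl (φ := φ)).range = q := by
      intro h1
      have := fc_normal_mem (SemidirectProduct.inl (φ := φ)).range y ((inl_mem y).2 h1)
      rw [card_inl, card_pq] at this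
      exact Nat.eq_of_mul_eq_mul_left hp.pos this
    by_cases hr : y.right = 1
    · rw [key hr]
      by_cases hy : y = 1
      · subst hy
        have hb := fc_one (⊥ : Subgroup (Multiplicative (ZMod p) ⋊[φ] Multiplicative (ZMod q)))
        have hi := fc_one (SemidirectProduct.inr (φ := φ)).range
        rw [card_pq, Subgroup.card_bot, one_mul] at hb
        rw [card_inr, card_pq, mul_comm p] at hi
        rw [hb, Nat.eq_of_mul_eq_mul_left hq.pos hi]
        push_cast; ring
      · rw [fc_normal_notMem ⊥ y (by simpa using hy)]
        have hi := fc_mul_card y (SemidirectProduct.inr (φ := φ)).range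
        have : IsEmpty {x : Multiplicative (ZMod p) ⋊[φ] Multiplicative (ZMod q) //
            x⁻¹ * y * x ∈ (SemidirectProduct.inr (φ := φ)).range} := by
          constructor
          rintro ⟨x, hx⟩
          apply hy
          have h1 := (inr_mem _).1 hx
          have h2 : (x⁻¹ * y * x).right = 1 := by simp [hr]
          have h3 : x⁻¹ * y * x = 1 := by ext <;> simp only [h1, h2] <;> simp
          have h4 : y = x * (x⁻¹ * y * x) * x⁻¹ := by group
          rw [h4, h3]; simp
        rw [card_inr, Nat.card_eq_zero.2 (Or.inl this)] at hi
        rw [(Nat.mul_eq_zero.1 hi).resolve_left hq.pos.ne']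
        push_cast; ring
    · rw [fc_inr hp hq hφ y hr, fc_normal_notMem ⊥ y (by
        intro h; apply hr; rw [Subgroup.mem_bot.1 h]; rfl),
        fc_normal_notMem _ y (fun h => hr ((inl_mem y).1 h))]
      push_cast; ring
  · have := pq_sum (φ := φ) hp hq (fun _ => 1)
    simp only [mul_one] at this
    rw [this]; ring
  · rw [pq_sum hp hq, card_inl, card_inr, Subgroup.card_bot, Subgroup.card_top, card_pq,
      padicValNat.mul hp.ne_zero hq.ne_zero]
    have : (2 : ℤ) ≤ q := by exact_mod_cast hq.two_le
    simp
    intro h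
    nlinarith

end pq

/-- Let `p` be a prime and `G̃` a finite group having a subquotient
isomorphic to `C_p × C_p` or to a nonabelian `C_p ⋊ C_q` with `q` prime and `C_q` acting
faithfully on `C_p` (a subquotient isomorphic to `Q` being recorded as a surjective
homomorphism from a subgroup of `G̃` onto `Q`). Then `G̃` has a Brauer relation
`Θ = ∑_H n_H·H` with `ord_p(∏_H |H|^{n_H}) ≠ 0`; moreover `Θ` can be taken to be obtained
by inflation (pullback along the surjection) and induction (pushforward along the
inclusion of the subgroup) from the relation `1 − ∑_{U ≤_p G} U + p·G` in `C_p × C_p`,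
respectively `1 − q·C_q − C_p + q·G` in `C_p ⋊ C_q`. -/
theorem exists_brauer_relation_of_subquotient {G' : Type*} [Group G'] [Finite G']
    (p : ℕ) (hp : p.Prime)
    (h : (∃ (H : Subgroup G') (f : ↥H →* Multiplicative (ZMod p × ZMod p)),
            Function.Surjective f)
       ∨ (∃ (q : ℕ), q.Prime ∧
            ∃ (φ : Multiplicative (ZMod q) →* MulAut (Multiplicative (ZMod p))),
              Function.Injective φ ∧
              ∃ (H : Subgroup G')
                (f : ↥H →* Multiplicative (ZMod p) ⋊[φ] Multiplicative (ZMod q)),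
                Function.Surjective f)) :
    ∃ n : Subgroup G' → ℤ,
      (∀ g : G', ∑ᶠ S : Subgroup G', n S * (fixedCosets g S : ℤ) = 0) ∧
      padicValRat p (∏ᶠ S : Subgroup G', (Nat.card S : ℚ) ^ (n S)) ≠ 0 ∧
      ((∃ (H : Subgroup G') (f : ↥H →* Multiplicative (ZMod p × ZMod p)),
          Function.Surjective f ∧
          ∀ S : Subgroup G',
            n S = ∑ᶠ T ∈ {T : Subgroup (Multiplicative (ZMod p × ZMod p)) |
                (T.comap f).map H.subtype = S}, cpcpRel p T)
       ∨ (∃ (q : ℕ), q.Prime ∧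
            ∃ (φ : Multiplicative (ZMod q) →* MulAut (Multiplicative (ZMod p))),
              Function.Injective φ ∧
              ∃ (H : Subgroup G')
                (f : ↥H →* Multiplicative (ZMod p) ⋊[φ] Multiplicative (ZMod q)),
                Function.Surjective f ∧
                ∀ S : Subgroup G',
                  n S = ∑ᶠ T ∈ {T : Subgroup (Multiplicative (ZMod p) ⋊[φ]
                      Multiplicative (ZMod q)) | (T.comap f).map H.subtype = S},
                    pqRel p q φ T)) := by
  classical
  have := Fact.mk hp
  rcases h with ⟨H, f, hf⟩ | ⟨q, hq, φ, hφ, H, f, hf⟩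
  · let _ : Fintype (Subgroup (Multiplicative (ZMod p × ZMod p))) := Fintype.ofFinite _
    obtain ⟨h1, h2, h3⟩ := cpcp_all p hp
    obtain ⟨g1, g2⟩ := general p hp H f hf (cpcpRel p) h1 h2 h3 _ rfl
    exact ⟨_, g1, g2, Or.inl ⟨H, f, hf, fun S => rfl⟩⟩
  · have := Fact.mk hq
    have hfin : Finite (Multiplicative (ZMod p) ⋊[φ] Multiplicative (ZMod q)) :=
      Finite.of_equiv _ SemidirectProduct.equivProd.symm
    let _ : Fintype (Subgroup (Multiplicative (ZMod p) ⋊[φ] Multiplicative (ZMod q))) :=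
      Fintype.ofFinite _
    obtain ⟨h1, h2, h3⟩ := pq_all hp hq hφ
    obtain ⟨g1, g2⟩ := general p hp H f hf (pqRel p q φ) h1 h2 h3 _ rfl
    exact ⟨_, g1, g2, Or.inr ⟨q, hq, φ, hφ, H, f, hf, fun S => rfl⟩⟩
end

section
/- Let p be a prime and let G̃ be a finite group admitting a Brauer relation Θ = ∑_H n_H·H with ord_p(∏_H |H|^{n_H}) ≠ 0. Then G̃ has a subquotient isomorphic either to C_p × C_p or to a nonabelian semidirect product C_p ⋊ C_q with q prime and C_q acting faithfully on C_p. -/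
theorem aux_card_coatom {P : Type*} [Group P] [Finite P] {p : ℕ} [Fact p.Prime]
    (hP : IsPGroup p P) (M : Subgroup P) (hM : IsCoatom M) [M.Normal] :
    Nat.card (P ⧸ M) = p := by
  have hQ : IsPGroup p (P ⧸ M) := hP.to_quotient M
  have hd : p ∣ Nat.card (P ⧸ M) := by
    rcases hQ.card_eq_or_dvd with h | h
    · exact absurd (Subgroup.index_eq_one.mp h) hM.1
    · exact h
  obtain ⟨x, hx⟩ := exists_prime_orderOf_dvd_card' p hd
  have hlt : M < (Subgroup.zpowers x).comap (QuotientGroup.mk' M) := by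
    refine lt_of_le_of_ne ?_ ?_
    · intro m hm
      rw [Subgroup.mem_comap]
      have : (QuotientGroup.mk' M) m = 1 := by simpa using hm
      rw [this]; exact one_mem _
    · intro h
      obtain ⟨y, rfl⟩ := QuotientGroup.mk'_surjective M x
      have hy : y ∈ M := by
        rw [h]; exact Subgroup.mem_zpowers _
      have : (QuotientGroup.mk' M) y = 1 := by simpa using hy
      rw [this, orderOf_one] at hx
      exact (Fact.out : p.Prime).one_lt.ne hx
  have htop := hM.2 _ hlt
  have : Subgroup.zpowers x = ⊤ := by
    rw [← Subgroup.comap_top (QuotientGroup.mk' M)] at htop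
    exact Subgroup.comap_injective (QuotientGroup.mk'_surjective M) htop
  rw [← hx, ← Nat.card_zpowers, this, Subgroup.card_top]

theorem aux_noncyclic {P : Type*} [Group P] [Finite P] {p : ℕ} [Fact p.Prime]
    (hP : IsPGroup p P) (hc : ¬ IsCyclic P) :
    ∃ f : P →* Multiplicative (ZMod p × ZMod p), Function.Surjective f := by
  have hn : Group.IsNilpotent P := hP.isNilpotent
  have hnc : NormalizerCondition P := Group.normalizerCondition_of_isNilpotent
  have h2 : ∃ M₁ M₂ : Subgroup P, IsCoatom M₁ ∧ IsCoatom M₂ ∧ M₁ ≠ M₂ := by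
    by_contra! h
    apply hc
    by_cases hM : ∃ M : Subgroup P, IsCoatom M
    · obtain ⟨M, hM⟩ := hM
      obtain ⟨x, hx⟩ : ∃ x, x ∉ M := by
        by_contra! h'
        exact hM.1 (eq_top_iff.2 fun x _ => h' x)
      refine ⟨x, fun y => ?_⟩
      rcases eq_top_or_exists_le_coatom (Subgroup.zpowers x) with h' | ⟨K, hK, hxK⟩
      · change y ∈ Subgroup.zpowers _; rw [h']; trivial
      · exact absurd (h K M hK hM ▸ hxK (Subgroup.mem_zpowers x)) hx
    · refine ⟨1, fun y => ?_⟩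
      rcases eq_top_or_exists_le_coatom (Subgroup.zpowers (1 : P)) with h' | ⟨K, hK, hxK⟩
      · change y ∈ Subgroup.zpowers _; rw [h']; trivial
      · exact absurd ⟨K, hK⟩ hM
  obtain ⟨M₁, M₂, h1, h2, hne⟩ := h2
  have n1 : M₁.Normal := Subgroup.NormalizerCondition.normal_of_coatom _ hnc h1
  have n2 : M₂.Normal := Subgroup.NormalizerCondition.normal_of_coatom _ hnc h2
  have hz : Nat.card (Multiplicative (ZMod p)) = p := by simp
  let e1 := mulEquivOfPrimeCardEq (aux_card_coatom hP M₁ h1) hz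
  let e2 := mulEquivOfPrimeCardEq (aux_card_coatom hP M₂ h2) hz
  let g1 := e1.toMonoidHom.comp (QuotientGroup.mk' M₁)
  let g2 := e2.toMonoidHom.comp (QuotientGroup.mk' M₂)
  have k1 : ∀ x ∈ M₁, g1 x = 1 := by
    intro x hx
    have : (QuotientGroup.mk' M₁) x = 1 := by simpa using hx
    simp only [g1, MonoidHom.comp_apply, this, map_one]
  have k2 : ∀ x ∈ M₂, g2 x = 1 := by
    intro x hx
    have : (QuotientGroup.mk' M₂) x = 1 := by simpa using hx
    simp only [g2, MonoidHom.comp_apply, this, map_one]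
  have s1 : Function.Surjective g1 := e1.surjective.comp (QuotientGroup.mk'_surjective _)
  have s2 : Function.Surjective g2 := e2.surjective.comp (QuotientGroup.mk'_surjective _)
  have hsup : M₁ ⊔ M₂ = ⊤ := by
    apply h1.2
    refine lt_of_le_of_ne le_sup_left fun h => ?_
    have : M₂ ≤ M₁ := by rw [h]; exact le_sup_right
    rcases this.lt_or_eq with h' | h'
    · exact h1.1 (h2.2 _ h')
    · exact hne h'.symm
  refine ⟨{ toFun := fun x => Multiplicative.ofAdd ((g1 x).toAdd, (g2 x).toAdd)
            map_one' := by simp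
            map_mul' := fun x y => by rw [map_mul g1, map_mul g2]; rfl }, ?_⟩
  intro z
  obtain ⟨a, ha⟩ := s1 (Multiplicative.ofAdd z.toAdd.1)
  obtain ⟨b, hb⟩ := s2 (Multiplicative.ofAdd z.toAdd.2)
  have ha' : a ∈ M₁ ⊔ M₂ := hsup ▸ Subgroup.mem_top a
  have hb' : b ∈ M₁ ⊔ M₂ := hsup ▸ Subgroup.mem_top b
  obtain ⟨a1, ha1, a2, ha2, rfl⟩ := Subgroup.mem_sup_of_normal_left.1 ha'
  obtain ⟨b1, hb1, b2, hb2, rfl⟩ := Subgroup.mem_sup_of_normal_left.1 hb'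
  refine ⟨b1 * a2, ?_⟩
  rw [map_mul, k1 _ ha1, one_mul] at ha
  rw [map_mul, k2 _ hb2, mul_one] at hb
  change Multiplicative.ofAdd ((g1 (b1 * a2)).toAdd, (g2 (b1 * a2)).toAdd) = z
  rw [map_mul g1, map_mul g2, k1 _ hb1, k2 _ ha2, one_mul, mul_one, ha, hb]
  rfl

theorem aux_burnside {G : Type*} [Group G] [Finite G] {p : ℕ} [Fact p.Prime]
    (P : Sylow p G) [hc : IsCyclic P]
    (h : ∀ W : Subgroup G, Nat.card W = p → ∀ x ∈ Subgroup.normalizer (W : Set G),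
      x ∈ Subgroup.centralizer (W : Set G)) :
    Subgroup.normalizer ((P : Subgroup G) : Set G) ≤
      Subgroup.centralizer ((P : Subgroup G) : Set G) := by
  have hp : p.Prime := Fact.out
  obtain ⟨k, hk⟩ := IsPGroup.iff_card.1 P.2
  obtain ⟨⟨g, hgP⟩, hg⟩ := hc.exists_generator
  have hgen : ∀ w ∈ P, ∃ i : ℤ, g ^ i = w := by
    intro w hw
    obtain ⟨i, hi⟩ := hg ⟨w, hw⟩
    exact ⟨i, by simpa using congrArg Subtype.val hi⟩
  have hog : orderOf g = p ^ k := by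
    have := orderOf_eq_card_of_forall_mem_zpowers hg
    rw [← hk, ← this, ← Subgroup.orderOf_coe]
  intro x hx
  -- suffices commuting with g
  suffices hxg : x * g * x⁻¹ = g by
    rw [Subgroup.mem_centralizer_iff]
    intro w hw
    obtain ⟨i, rfl⟩ := hgen w hw
    have : Commute x g := by
      rw [mul_inv_eq_iff_eq_mul] at hxg; exact hxg
    exact (this.zpow_right i).eq.symm
  rcases Nat.eq_zero_or_pos k with rfl | hkpos
  · have : g = 1 := by
      rw [pow_zero, orderOf_eq_one_iff] at hog; exact hog
    simp [this]
  obtain ⟨j, rfl⟩ : ∃ j, k = j + 1 := ⟨k - 1, by omega⟩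
  obtain ⟨m, hm⟩ := hgen (x * g * x⁻¹) ((Subgroup.mem_normalizer_iff.1 hx g).1 hgP)
  have hconj : ∀ i : ℤ, x * g ^ i * x⁻¹ = g ^ (m * i) := by
    intro i
    rw [← conj_zpow, ← hm, ← zpow_mul]
  have hiter : ∀ N : ℕ, x ^ N * g * (x ^ N)⁻¹ = g ^ (m ^ N) := by
    intro N
    induction N with
    | zero => simp
    | succ N ih =>
      have : x ^ (N+1) * g * (x ^ (N+1))⁻¹ = x * (x ^ N * g * (x ^ N)⁻¹) * x⁻¹ := by
        rw [pow_succ']; group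
      rw [this, ih, hconj, pow_succ', ]
  let w := g ^ (p ^ j)
  have how : orderOf w = p := by
    rw [orderOf_pow_of_dvd (pow_pos hp.pos j).ne' (by rw [hog]; exact pow_dvd_pow p (by omega)),
      hog, pow_succ, Nat.mul_div_cancel_left _ (pow_pos hp.pos j)]
  have hxw : x * w * x⁻¹ = w ^ m := by
    have := hconj ((p ^ j : ℕ) : ℤ)
    rw [zpow_natCast, mul_comm, zpow_mul, zpow_natCast] at this
    exact this
  have hnorm : x ∈ Subgroup.normalizer ((Subgroup.zpowers w : Subgroup G) : Set G) := by
    apply Subgroup.mem_normalizer_fintype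
    rintro _ ⟨i, rfl⟩
    refine ⟨m * i, ?_⟩
    change w ^ (m * i) = x * w ^ i * x⁻¹
    rw [← conj_zpow, hxw, zpow_mul]
  have hcent := h (Subgroup.zpowers w) (by rw [Nat.card_zpowers, how]) x hnorm
  have hxw2 : w ^ m = w := by
    rw [← hxw, mul_inv_eq_iff_eq_mul]
    exact (Subgroup.mem_centralizer_iff.1 hcent w (Subgroup.mem_zpowers w)).symm
  have hdvd : (p : ℤ) ∣ m - 1 := by
    rw [← how]
    apply orderOf_dvd_iff_zpow_eq_one.2
    rw [zpow_sub, hxw2, zpow_one, mul_inv_cancel]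
  have hdvd2 := dvd_sub_pow_of_dvd_sub hdvd j
  rw [one_pow] at hdvd2
  have hcomm1 : Commute (x ^ (p ^ j)) g := by
    have h1 := hiter (p ^ j)
    have h2 : g ^ (m ^ (p ^ j)) = g := by
      have : g ^ (m ^ (p ^ j) - 1) = 1 := by
        apply orderOf_dvd_iff_zpow_eq_one.1
        rw [hog]; push_cast; exact hdvd2
      rw [zpow_sub, zpow_one, mul_inv_eq_one] at this
      exact this
    rw [h2, mul_inv_eq_iff_eq_mul] at h1
    exact h1
  let r := ((P : Subgroup G).subgroupOf (Subgroup.normalizer ((P : Subgroup G) : Set G))).index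
  have hr : ¬ p ∣ r := fun h' =>
    P.not_dvd_index (h'.trans (Subgroup.relIndex_dvd_index_of_le Subgroup.le_normalizer))
  have hxr : x ^ r ∈ P := by
    have := Subgroup.pow_index_mem
      ((P : Subgroup G).subgroupOf (Subgroup.normalizer ((P : Subgroup G) : Set G))) ⟨x, hx⟩
    exact this
  have hcomm2 : Commute (x ^ r) g := by
    obtain ⟨i, hi⟩ := hgen _ hxr
    rw [← hi]
    exact (Commute.refl g).zpow_left i
  have hcop : IsCoprime ((p ^ j : ℕ) : ℤ) (r : ℤ) :=
    Nat.isCoprime_iff_coprime.2 (Nat.Coprime.pow_left j (hp.coprime_iff_not_dvd.2 hr))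
  obtain ⟨u, v, huv⟩ := hcop
  have hcomm : Commute x g := by
    have : x = (x ^ (p ^ j)) ^ u * (x ^ r) ^ v := by
      rw [← zpow_natCast x, ← zpow_natCast x, ← zpow_mul, ← zpow_mul, ← zpow_add, mul_comm _ u,
        mul_comm _ v, huv, zpow_one]
    rw [this]
    exact (hcomm1.zpow_left u).mul_left (hcomm2.zpow_left v)
  rw [mul_inv_eq_iff_eq_mul]; exact hcomm

theorem aux_faithful {G : Type*} [Group G] [Finite G] {p : ℕ} [Fact p.Prime]
    (W : Subgroup G) (hW : Nat.card W = p) (x : G)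
    (hx : x ∈ Subgroup.normalizer (W : Set G)) (hxc : x ∉ Subgroup.centralizer (W : Set G)) :
    ∃ (q : ℕ), q.Prime ∧
        ∃ (φ : Multiplicative (ZMod q) →* MulAut (Multiplicative (ZMod p))),
          Function.Injective φ ∧
          ∃ (H : Subgroup G)
            (f : ↥H →* Multiplicative (ZMod p) ⋊[φ] Multiplicative (ZMod q)),
            Function.Surjective f := by
  have hp : p.Prime := Fact.out
  have hcyc : IsCyclic W := isCyclic_of_prime_card hW
  let ρ := W.normalizerMonoidHom
  have hcard : Nat.card (MulAut W) = p - 1 := by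
    rw [IsCyclic.card_mulAut, hW, Nat.totient_prime hp]
  have hcop : Nat.Coprime p (p - 1) := by
    rw [hp.coprime_iff_not_dvd]
    intro h
    have := Nat.le_of_dvd (by have := hp.two_le; omega) h
    have := hp.two_le
    omega
  have hord : ∀ α : MulAut W, Nat.Coprime (orderOf α) p := fun α =>
    Nat.Coprime.coprime_dvd_left (hcard ▸ orderOf_dvd_natCard α) hcop.symm
  let x' : Subgroup.normalizer (W : Set G) := ⟨x, hx⟩
  have hρx : ρ x' ≠ 1 := by
    intro h
    have : x' ∈ ρ.ker := h
    rw [Subgroup.normalizerMonoidHom_ker, Subgroup.mem_subgroupOf] at this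
    exact hxc this
  obtain ⟨a, m, hm, hxm⟩ := Nat.exists_eq_pow_mul_and_not_dvd
    (orderOf_pos x').ne' p hp.ne_one
  let z := x' ^ (p ^ a)
  have hz : ¬ p ∣ orderOf z := by
    have : orderOf z ∣ m := by
      apply orderOf_dvd_of_pow_eq_one
      rw [← pow_mul, ← hxm, pow_orderOf_eq_one]
    exact fun h => hm (h.trans this)
  have hρz : ρ z ≠ 1 := by
    intro h
    rw [map_pow] at h
    have h1 := orderOf_dvd_of_pow_eq_one h
    have := Nat.Coprime.eq_one_of_dvd ((hord (ρ x')).pow_right a) h1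
    exact hρx (orderOf_eq_one_iff.1 this)
  obtain ⟨q, hq, hqd⟩ := Nat.exists_prime_and_dvd (mt orderOf_eq_one_iff.1 hρz)
  obtain ⟨r, hr⟩ := hqd
  have hr0 : r ≠ 0 := by
    rintro rfl
    exact (orderOf_pos (ρ z)).ne' (by simpa using hr)
  let y := z ^ r
  have hρy : orderOf (ρ y) = q := by
    rw [map_pow, orderOf_pow_of_dvd hr0 (hr ▸ Dvd.intro_left q rfl), hr,
      Nat.mul_div_cancel _ (Nat.pos_of_ne_zero hr0)]
  have hy : Nat.Coprime p (orderOf (y : G)) := by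
    rw [hp.coprime_iff_not_dvd, Subgroup.orderOf_coe]
    exact fun h => hz (h.trans (orderOf_pow_dvd r))
  let X := Subgroup.zpowers (y : G)
  have hX : X ≤ Subgroup.normalizer (W : Set G) := by
    rw [Subgroup.zpowers_le]; exact y.2
  have hdisj : W ⊓ X = ⊥ := by
    rw [← disjoint_iff]
    apply Subgroup.disjoint_of_coprime_natCard
    rw [hW, Nat.card_zpowers]; exact hy
  let ι := SemidirectProduct.monoidHomSubgroup hX
  have hι : Function.Injective ι := by
    rw [injective_iff_map_eq_one]
    rintro ⟨w, t⟩ h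
    have h' : (w : G) * (t : G) = 1 := by
      simpa [ι, SemidirectProduct.monoidHomSubgroup, SemidirectProduct.lift] using h
    have hw : (w : G) ∈ W ⊓ X := ⟨w.2, by
      rw [eq_inv_of_mul_eq_one_left h']; exact X.inv_mem t.2⟩
    rw [hdisj, Subgroup.mem_bot] at hw
    rw [hw, one_mul] at h'
    ext
    · simpa using hw
    · simpa using h'
  have hzp : Nat.card (Multiplicative (ZMod p)) = p := by simp
  have : Fact q.Prime := ⟨hq⟩
  have hzq : Nat.card (Multiplicative (ZMod q)) = q := Nat.card_zmod q
  let e := mulEquivOfPrimeCardEq hW hzp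
  let ψ : X →* MulAut W := ρ.comp (Subgroup.inclusion hX)
  let φ0 : X →* MulAut (Multiplicative (ZMod p)) := (MulAut.congr e).toMonoidHom.comp ψ
  have hR : Nat.card φ0.range = q := by
    have h1 : φ0.range = ψ.range.map (MulAut.congr e).toMonoidHom := by
      rw [MonoidHom.range_comp]
    have h2 : ψ.range = Subgroup.zpowers (ρ y) := by
      ext α
      constructor
      · rintro ⟨⟨_, k, rfl⟩, rfl⟩
        refine ⟨k, ?_⟩
        change (ρ y) ^ k = ρ _
        rw [← map_zpow]
        congr 1
      · rintro ⟨k, rfl⟩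
        refine ⟨⟨(y : G) ^ k, k, rfl⟩, ?_⟩
        change ρ _ = (ρ y) ^ k
        rw [← map_zpow]
        congr 1
    rw [h1, Subgroup.card_map_of_injective (MulAut.congr e).injective, h2, Nat.card_zpowers, hρy]
  let e2 := mulEquivOfPrimeCardEq hR hzq
  let φ : Multiplicative (ZMod q) →* MulAut (Multiplicative (ZMod p)) :=
    φ0.range.subtype.comp e2.symm.toMonoidHom
  have hφ : Function.Injective φ := φ0.range.subtype_injective.comp e2.symm.injective
  let F : W ⋊[ψ] X →* Multiplicative (ZMod p) ⋊[φ] Multiplicative (ZMod q) :=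
    SemidirectProduct.map e.toMonoidHom (e2.toMonoidHom.comp φ0.rangeRestrict) (by
      intro g
      ext w
      have h1 : φ (e2 (φ0.rangeRestrict g)) = φ0 g := by
        change ((e2.symm (e2 (φ0.rangeRestrict g)) : φ0.range) : MulAut _) = φ0 g
        rw [MulEquiv.symm_apply_apply]; rfl
      change e (ψ g w) = φ (e2 (φ0.rangeRestrict g)) (e w)
      rw [h1]
      change e (ψ g w) = e (ψ g (e.symm (e w)))
      rw [MulEquiv.symm_apply_apply])
  have hF : Function.Surjective F := by
    rintro ⟨u, v⟩
    obtain ⟨w, rfl⟩ := e.surjective u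
    obtain ⟨v', rfl⟩ := e2.surjective v
    obtain ⟨t, rfl⟩ := φ0.rangeRestrict_surjective v'
    exact ⟨⟨w, t⟩, rfl⟩
  exact ⟨q, hq, φ, hφ, ι.range, F.comp (MonoidHom.ofInjective hι).symm.toMonoidHom,
    hF.comp (MonoidHom.ofInjective hι).symm.surjective⟩

theorem aux_fiber {G A : Type*} [Group G] [Finite G] [Group A]
    (hA : ∀ a b : A, a * b = b * a) (f : G →* A) (t : A) (H : Subgroup G) (x : G ⧸ H) :
    Nat.card {y : {y : G // f y = t} // (y : G) • x = x} = Nat.card {h : H // f h = t} := by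
  obtain ⟨a, rfl⟩ := QuotientGroup.mk_surjective x
  have key : ∀ y : G, y • (QuotientGroup.mk a : G ⧸ H) = QuotientGroup.mk a ↔ a⁻¹ * y * a ∈ H := by
    intro y
    rw [MulAction.Quotient.smul_mk, eq_comm, QuotientGroup.eq, smul_eq_mul, mul_assoc]
  have hf : ∀ y : G, f (a⁻¹ * y * a) = f y := by
    intro y
    rw [map_mul, map_mul, hA (f a⁻¹), mul_assoc, ← map_mul, inv_mul_cancel, map_one, mul_one]
  have hf' : ∀ y : G, f (a * y * a⁻¹) = f y := by
    intro y
    rw [map_mul, map_mul, hA (f a), mul_assoc, ← map_mul, mul_inv_cancel, map_one, mul_one]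
  refine Nat.card_congr
    { toFun := fun y => ⟨⟨a⁻¹ * y.1.1 * a, (key _).1 y.2⟩, (hf _).trans y.1.2⟩
      invFun := fun h => ⟨⟨a * h.1.1 * a⁻¹, (hf' _).trans h.2⟩, (key _).2 (by
        have : a⁻¹ * (a * h.1.1 * a⁻¹) * a = h.1.1 := by group
        rw [this]; exact h.1.2)⟩
      left_inv := fun y => by
        ext; change a * (a⁻¹ * y.1.1 * a) * a⁻¹ = y.1.1; group
      right_inv := fun h => by
        ext; change a⁻¹ * (a * h.1.1 * a⁻¹) * a = h.1.1; group }

open Classical in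
theorem aux_count {G A : Type*} [Group G] [Finite G] [Group A]
    (hA : ∀ a b : A, a * b = b * a) (f : G →* A) (t : A) (H : Subgroup G)
    [Fintype {y : G // f y = t}] :
    (∑ y : {y : G // f y = t}, fixedCosets (y : G) H) * Nat.card (H.map f) =
      if t ∈ H.map f then Nat.card G else 0 := by
  have : Fintype (G ⧸ H) := Fintype.ofFinite _
  have h1 : (∑ y : {y : G // f y = t}, fixedCosets (y : G) H) =
      H.index * Nat.card {h : H // f h = t} := by
    unfold fixedCosets
    rw [← Nat.card_sigma]
    have e : (Σ y : {y : G // f y = t}, {x : G ⧸ H // (y : G) • x = x}) ≃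
        (Σ x : G ⧸ H, {y : {y : G // f y = t} // (y : G) • x = x}) :=
      { toFun := fun s => ⟨s.2.1, s.1, s.2.2⟩
        invFun := fun s => ⟨s.2.1, s.1, s.2.2⟩
        left_inv := fun s => rfl
        right_inv := fun s => rfl }
    rw [Nat.card_congr e, Nat.card_sigma, Finset.sum_congr rfl (fun x _ => aux_fiber hA f t H x),
      Finset.sum_const, Finset.card_univ, smul_eq_mul, Subgroup.index,
      Nat.card_eq_fintype_card (α := G ⧸ H)]
  rw [h1]
  let fH : H →* A := f.comp H.subtype
  have hr : fH.range = H.map f := by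
    simp [fH, MonoidHom.range_comp]
  split_ifs with ht
  · obtain ⟨h0, hh0, rfl⟩ := ht
    have h2 : Nat.card {h : H // f h = f h0} = Nat.card fH.ker :=
      Nat.card_congr (fH.fiberEquivKer ⟨h0, hh0⟩)
    rw [h2, ← hr, ← Subgroup.index_ker, mul_assoc, Subgroup.card_mul_index, mul_comm,
      Subgroup.card_mul_index]
  · have : IsEmpty {h : H // f h = t} := ⟨fun h => ht ⟨h.1.1, h.1.2, h.2⟩⟩
    rw [Nat.card_of_isEmpty]; simp

theorem aux_padic {ι : Type*} (p : ℕ) [Fact p.Prime] (s : Finset ι) (a : ι → ℚ)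
    (ha : ∀ i, a i ≠ 0) (n : ι → ℤ) :
    padicValRat p (∏ i ∈ s, a i ^ n i) = ∑ i ∈ s, n i * padicValRat p (a i) := by
  classical
  induction s using Finset.induction_on with
  | empty => simp
  | insert i s hi ih =>
    rw [Finset.prod_insert hi, Finset.sum_insert hi, padicValRat.mul (zpow_ne_zero _ (ha i))
      (Finset.prod_ne_zero_iff.2 fun j _ => zpow_ne_zero _ (ha j)), ih, padicValRat.zpow]

open Classical in
theorem aux_vanish {G A : Type*} [Group G] [Finite G] [Group A] [Finite A] [IsCyclic A]
    (f : G →* A) (n : Subgroup G → ℤ) [Fintype (Subgroup G)]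
    (hrel : ∀ g : G, ∑ S : Subgroup G, n S * (fixedCosets g S : ℤ) = 0) (T : Subgroup A) :
    ∑ S : Subgroup G with S.map f = T, n S = 0 := by
  have : Fintype G := Fintype.ofFinite _
  have : Fintype (Subgroup A) := Fintype.ofFinite _
  have hA : ∀ a b : A, a * b = b * a := fun a b => (IsCyclic.commGroup (α := A)).mul_comm a b
  have hpos : ∀ S : Subgroup A, (Nat.card S : ℚ) ≠ 0 := fun S =>
    Nat.cast_ne_zero.2 Nat.card_pos.ne'
  have h1 : ∀ t : A, ∑ S : Subgroup G, (if t ∈ S.map f then (n S : ℚ) / Nat.card (S.map f) else 0)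
      = 0 := by
    intro t
    have h2 : ∑ y : {y : G // f y = t}, ∑ S : Subgroup G,
        (n S : ℚ) * (fixedCosets (y : G) S : ℚ) = 0 := by
      apply Finset.sum_eq_zero
      intro y _
      exact_mod_cast hrel y
    rw [Finset.sum_comm] at h2
    have h3 : ∀ S : Subgroup G, ∑ y : {y : G // f y = t}, (n S : ℚ) * (fixedCosets (y : G) S : ℚ)
        = (Nat.card G : ℚ) * (if t ∈ S.map f then (n S : ℚ) / Nat.card (S.map f) else 0) := by
      intro S
      have h4 := congrArg (Nat.cast (R := ℚ)) (aux_count hA f t S)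
      rw [← Finset.mul_sum]
      push_cast at h4
      have h5 := hpos (S.map f)
      rw [← eq_div_iff h5] at h4
      rw [h4]
      split_ifs
      · ring
      · simp
    rw [Finset.sum_congr rfl fun S _ => h3 S, ← Finset.mul_sum] at h2
    exact (mul_eq_zero.1 h2).resolve_left (Nat.cast_ne_zero.2 Nat.card_pos.ne')
  have h2 : ∀ T : Subgroup A, ∑ S : Subgroup G,
      (if T ≤ S.map f then (n S : ℚ) / Nat.card (S.map f) else 0) = 0 := by
    intro T
    obtain ⟨t, ht⟩ := (Subgroup.isCyclic_iff_exists_zpowers_eq_top T).1 inferInstance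
    refine Eq.trans ?_ (h1 t)
    refine Finset.sum_congr rfl fun S _ => ?_
    rw [← ht, Subgroup.zpowers_le]
  have h3 : ∀ T : Subgroup A, ∑ U : Subgroup A, (if T ≤ U then
      ((∑ S : Subgroup G with S.map f = U, n S : ℤ) : ℚ) / Nat.card U else 0) = 0 := by
    intro T
    refine Eq.trans ?_ (h2 T)
    rw [← Finset.sum_fiberwise (s := Finset.univ) (g := fun S : Subgroup G => S.map f)]
    refine Finset.sum_congr rfl fun U _ => ?_
    split_ifs with hU
    · push_cast
      rw [Finset.sum_div]
      refine Finset.sum_congr rfl fun S hS => ?_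
      obtain rfl := (Finset.mem_filter.1 hS).2
      rw [if_pos hU]
    · symm
      refine Finset.sum_eq_zero fun S hS => ?_
      obtain rfl := (Finset.mem_filter.1 hS).2
      rw [if_neg hU]
  induction T using WellFoundedGT.induction with
  | ind T ih =>
    have h4 := h3 T
    rw [Finset.sum_eq_single T, if_pos le_rfl, div_eq_zero_iff] at h4
    · exact_mod_cast h4.resolve_right (hpos T)
    · intro U _ hU
      split_ifs with hTU
      · rw [ih U (lt_of_le_of_ne hTU hU.symm)]; simp
      · rfl
    · simp

theorem aux_final {G A : Type*} [Group G] [Finite G] [Group A] [Finite A] [IsCyclic A]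
    (p : ℕ) [Fact p.Prime]
    (f : G →* A) (hf : ¬ p ∣ Nat.card f.ker) (n : Subgroup G → ℤ)
    (hrel : ∀ g : G, ∑ᶠ S : Subgroup G, n S * (fixedCosets g S : ℤ) = 0) :
    padicValRat p (∏ᶠ S : Subgroup G, (Nat.card S : ℚ) ^ (n S)) = 0 := by
  classical
  have : Fintype (Subgroup G) := Fintype.ofFinite _
  have : Fintype (Subgroup A) := Fintype.ofFinite _
  simp only [finsum_eq_sum_of_fintype] at hrel
  rw [finprod_eq_prod_of_fintype, aux_padic p _ _ (fun S => Nat.cast_ne_zero.2 Nat.card_pos.ne')]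
  have h1 : ∀ S : Subgroup G, padicValRat p (Nat.card S : ℚ) =
      padicValRat p (Nat.card (S.map f) : ℚ) := by
    intro S
    let fS : S →* A := f.comp S.subtype
    have hr : fS.range = S.map f := by
      simp [fS, MonoidHom.range_comp]
    have hk : Nat.card fS.ker ∣ Nat.card f.ker := by
      exact Subgroup.card_comap_dvd_of_injective f.ker S.subtype Subtype.coe_injective
    rw [← Subgroup.card_mul_index fS.ker, Subgroup.index_ker, hr, Nat.cast_mul, padicValRat.mul
      (Nat.cast_ne_zero.2 Nat.card_pos.ne') (Nat.cast_ne_zero.2 Nat.card_pos.ne'),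
      padicValRat.of_nat, padicValNat.eq_zero_of_not_dvd fun h => hf (h.trans hk)]
    simp
  rw [← Finset.sum_fiberwise (s := Finset.univ) (g := fun S : Subgroup G => S.map f)]
  refine Finset.sum_eq_zero fun U _ => ?_
  have h2 : ∀ S ∈ Finset.univ.filter (fun S : Subgroup G => S.map f = U),
      n S * padicValRat p (Nat.card S : ℚ) = n S * padicValRat p (Nat.card U : ℚ) := by
    intro S hS
    obtain rfl := (Finset.mem_filter.1 hS).2
    rw [h1]
  rw [Finset.sum_congr rfl h2, ← Finset.sum_mul, aux_vanish f n hrel U, zero_mul]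

/-- Let `p` be a prime and `G̃` a finite group admitting a Brauer relation
`Θ = ∑_H n_H·H` with `ord_p(∏_H |H|^{n_H}) ≠ 0`. Then `G̃` has a subquotient isomorphic
either to `C_p × C_p` or to a nonabelian `C_p ⋊ C_q` with `q` prime and `C_q` acting
faithfully on `C_p` (a subquotient isomorphic to `Q` being recorded as a surjective
homomorphism from a subgroup of `G̃` onto `Q`). -/
theorem subquotient_of_brauer_relation {G' : Type*} [Group G'] [Finite G']
    (p : ℕ) (hp : p.Prime)
    (n : Subgroup G' → ℤ)
    (hrel : ∀ g : G', ∑ᶠ S : Subgroup G', n S * (fixedCosets g S : ℤ) = 0)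
    (hord : padicValRat p (∏ᶠ S : Subgroup G', (Nat.card S : ℚ) ^ (n S)) ≠ 0) :
    (∃ (H : Subgroup G') (f : ↥H →* Multiplicative (ZMod p × ZMod p)),
        Function.Surjective f)
    ∨ (∃ (q : ℕ), q.Prime ∧
        ∃ (φ : Multiplicative (ZMod q) →* MulAut (Multiplicative (ZMod p))),
          Function.Injective φ ∧
          ∃ (H : Subgroup G')
            (f : ↥H →* Multiplicative (ZMod p) ⋊[φ] Multiplicative (ZMod q)),
            Function.Surjective f) := by
  have : Fact p.Prime := ⟨hp⟩
  by_contra hcon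
  rw [not_or] at hcon
  obtain ⟨hA, hB⟩ := hcon
  let P : Sylow p G' := default
  have hc : IsCyclic P := by
    by_contra hc
    obtain ⟨f, hf⟩ := aux_noncyclic P.2 hc
    exact hA ⟨P, f, hf⟩
  have hN := aux_burnside P (fun W hW x hx => by
    by_contra hxc
    exact hB (aux_faithful W hW x hx hxc))
  exact hord (aux_final p (MonoidHom.transferSylow P hN)
    (MonoidHom.not_dvd_card_ker_transferSylow P hN) n hrel)
end
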